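/- For every t > 0 and h > 0, one has ∂_t F_N(t,h) − (∂_h F_N(t,h))² = E⟨((σ·σ')/N)²⟩ − (E⟨(σ·σ')/N⟩)², i.e., the defect in the Hamilton–Jacobi equation ∂_t F_N = (∂_h F_N)² equals the variance of the overlap (σ·σ')/N under the measure E⟨·⟩; in particular this quantity is nonnegative. -/

import Mathlib

open MeasureTheory ProbabilityTheory Real Filter
open scoped NNReal

/-- The law of the randomness of the enriched SK model: i.i.d. standard Gaussian
coefficients `(W_{ij})_{1 ≤ i,j ≤ N}` together with an independent vector
`z = (z_1, …, z_N)` of i.i.d. standard Gaussians. -/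
noncomputable def measWZ (N : ℕ) : Measure (((Fin N × Fin N) → ℝ) × (Fin N → ℝ)) :=
  (Measure.pi fun _ : Fin N × Fin N => gaussianReal 0 1).prod
    (Measure.pi fun _ : Fin N => gaussianReal 0 1)

/-- The Sherrington–Kirkpatrick Hamiltonian. -/
noncomputable def HSK (N : ℕ) (W : (Fin N × Fin N) → ℝ) (σ : Fin N → ℝ) : ℝ :=
  (1 / Real.sqrt N) * ∑ i : Fin N, ∑ j : Fin N, W (i, j) * σ i * σ j

/-- The enriched SK Hamiltonian
`H_N(t,h,σ) = √(2t) H_N(σ) − Nt + √(2h) z·σ − Nh`. -/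
noncomputable def Henr (N : ℕ) (t h : ℝ) (ω : ((Fin N × Fin N) → ℝ) × (Fin N → ℝ))
    (σ : Fin N → ℝ) : ℝ :=
  Real.sqrt (2 * t) * HSK N ω.1 σ - N * t
    + Real.sqrt (2 * h) * (∑ i : Fin N, ω.2 i * σ i) - N * h

/-- The partition function of the enriched SK model. -/
noncomputable def Zenr (N : ℕ) (t h : ℝ)
    (ω : ((Fin N × Fin N) → ℝ) × (Fin N → ℝ)) : ℝ :=
  ∑ σ : Fin N → ({-1, 1} : Finset ℝ), Real.exp (Henr N t h ω fun i => (σ i : ℝ))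

/-- The enriched free energy `F_N(t,h) = −N^{-1} E[log ∑_σ exp(H_N(t,h,σ))]`. -/
noncomputable def Fenr (N : ℕ) (t h : ℝ) : ℝ :=
  -(1 / N) * ∫ ω, Real.log (Zenr N t h ω) ∂(measWZ N)

/-- The averaged Gibbs bracket `E⟨f((σ·σ')/N)⟩` of a function of the overlap of two
independent samples `σ, σ'` from the Gibbs measure with weights proportional to
`exp(H_N(t,h,σ))`. -/
noncomputable def gibbsOverlap (N : ℕ) (t h : ℝ) (f : ℝ → ℝ) : ℝ :=
  ∫ ω, (∑ σ : Fin N → ({-1, 1} : Finset ℝ), ∑ σ' : Fin N → ({-1, 1} : Finset ℝ),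
      f ((∑ i : Fin N, (σ i : ℝ) * (σ' i : ℝ)) / N) *
        Real.exp (Henr N t h ω (fun i => (σ i : ℝ)) + Henr N t h ω fun i => (σ' i : ℝ)))
    / (Zenr N t h ω) ^ 2 ∂(measWZ N)

/-- **Stein's identity** for the standard Gaussian law on the real line. -/
lemma integral_id_mul_gaussianReal {f f' : ℝ → ℝ} {C C' : ℝ}
    (hf : ∀ x, HasDerivAt f (f' x) x) (hf' : Measurable f')
    (hC : ∀ x, ‖f x‖ ≤ C) (hC' : ∀ x, ‖f' x‖ ≤ C') :
    ∫ x, x * f x ∂gaussianReal 0 1 = ∫ x, f' x ∂gaussianReal 0 1 := by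
  have hfm : Measurable f :=
    (continuous_iff_continuousAt.2 fun x => (hf x).continuousAt).measurable
  have hpdf : ∀ x : ℝ, gaussianPDFReal 0 1 x = (√(2 * π))⁻¹ * rexp (-(1 / 2) * x ^ 2) := by
    intro x
    simp only [gaussianPDFReal_def, NNReal.coe_one]
    congr 2 <;> ring_nf
  have hderiv : ∀ x, HasDerivAt (gaussianPDFReal 0 1) (-(x * gaussianPDFReal 0 1 x)) x := by
    intro x
    rw [show gaussianPDFReal 0 1 = fun x : ℝ => (√(2 * π))⁻¹ * rexp (-(1 / 2) * x ^ 2) from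
      funext hpdf]
    convert! ((((hasDerivAt_id x).pow 2).const_mul (-(1 / 2 : ℝ))).exp.const_mul
      (√(2 * π))⁻¹) using 1
    simp only [Pi.pow_apply, id_eq]
    ring
  have hxg : Integrable (fun x : ℝ => x * gaussianPDFReal 0 1 x) := by
    simp_rw [hpdf]
    refine ((integrable_mul_exp_neg_mul_sq (b := 1 / 2) (by norm_num)).const_mul
      (√(2 * π))⁻¹).congr (ae_of_all _ fun x => ?_)
    ring
  have hg := integrable_gaussianPDFReal 0 1
  have key := integral_mul_deriv_eq_deriv_mul_of_integrable
    (u := f) (v := gaussianPDFReal 0 1) (u' := f') (v' := fun x => -(x * gaussianPDFReal 0 1 x))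
    (fun x _ => hf x) (fun x _ => hderiv x)
    (hxg.neg.bdd_mul hfm.aestronglyMeasurable (ae_of_all _ hC))
    (hg.bdd_mul hf'.aestronglyMeasurable (ae_of_all _ hC'))
    (hg.bdd_mul hfm.aestronglyMeasurable (ae_of_all _ hC))
  rw [integral_gaussianReal_eq_integral_smul one_ne_zero,
    integral_gaussianReal_eq_integral_smul one_ne_zero]
  simp only [smul_eq_mul]
  rw [show (fun x => gaussianPDFReal 0 1 x * (x * f x))
      = fun x => -(f x * -(x * gaussianPDFReal 0 1 x)) by ext; ring, integral_neg, key, neg_neg]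
  simp_rw [mul_comm (f' _)]

section Stein

variable {Ω : Type*} [MeasurableSpace Ω] {μ : Measure Ω} [IsProbabilityMeasure μ]

/-- Stein's identity for a coordinate `X` of a probability space such that resampling `X` by `T`
from the standard Gaussian law preserves the probability. -/
lemma integral_mul_of_measurePreserving {X : Ω → ℝ} {T : ℝ → Ω → Ω} {F F' : Ω → ℝ} {C C' : ℝ}
    (hT : MeasurePreserving (fun p : ℝ × Ω => T p.1 p.2) ((gaussianReal 0 1).prod μ) μ)
    (hX : Measurable X) (hXT : ∀ x ω, X (T x ω) = x)
    (hF : Measurable F) (hF' : Measurable F')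
    (hC : ∀ ω, ‖F ω‖ ≤ C) (hC' : ∀ ω, ‖F' ω‖ ≤ C')
    (hderiv : ∀ x ω, HasDerivAt (fun y => F (T y ω)) (F' (T x ω)) x) :
    ∫ ω, X ω * F ω ∂μ = ∫ ω, F' ω ∂μ := by
  have hid : Integrable (fun x : ℝ => x) (gaussianReal 0 1) :=
    (memLp_id_gaussianReal 1).integrable le_rfl
  have hF'i : Integrable (fun p : ℝ × Ω => F' (T p.1 p.2)) ((gaussianReal 0 1).prod μ) :=
    .of_bound (hF'.comp hT.measurable).aestronglyMeasurable C' (ae_of_all _ fun _ => hC' _)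
  have hXFi : Integrable (fun p : ℝ × Ω => p.1 * F (T p.1 p.2)) ((gaussianReal 0 1).prod μ) :=
    (hid.comp_fst μ).mul_bdd (hF.comp hT.measurable).aestronglyMeasurable
      (ae_of_all _ fun _ => hC _)
  rw [← hT.map_eq, integral_map (f := fun ω => X ω * F ω) hT.aemeasurable
    (hX.mul hF).aestronglyMeasurable, integral_map hT.aemeasurable hF'.aestronglyMeasurable]
  simp only [hXT]
  rw [integral_prod_symm _ hXFi, integral_prod_symm _ hF'i]
  refine integral_congr_ae (ae_of_all _ fun ω => ?_)
  exact integral_id_mul_gaussianReal (fun x => hderiv x ω)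
    (hF'.comp (hT.measurable.comp measurable_prodMk_right)) (fun _ => hC _) fun _ => hC' _

lemma integrable_of_measurePreserving_resample {X : Ω → ℝ} {T : ℝ → Ω → Ω}
    (hT : MeasurePreserving (fun p : ℝ × Ω => T p.1 p.2) ((gaussianReal 0 1).prod μ) μ)
    (hX : Measurable X) (hXT : ∀ x ω, X (T x ω) = x) : Integrable X μ := by
  have hid : Integrable (fun x : ℝ => x) (gaussianReal 0 1) :=
    (memLp_id_gaussianReal 1).integrable le_rfl
  rw [← hT.integrable_comp hX.aestronglyMeasurable]
  simpa only [Function.comp_def, hXT] using hid.comp_fst μ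

end Stein

/-- Resampling one coordinate of a product of probability measures preserves the product. -/
lemma measurePreserving_update_pi {κ : Type*} [Fintype κ] [DecidableEq κ] (ν : κ → Measure ℝ)
    [∀ k, IsProbabilityMeasure (ν k)] (k : κ) :
    MeasurePreserving (fun p : ℝ × (κ → ℝ) => Function.update p.2 k p.1)
      ((ν k).prod (Measure.pi ν)) (Measure.pi ν) := by
  have hm : Measurable fun p : ℝ × (κ → ℝ) => Function.update p.2 k p.1 := by
    refine measurable_pi_iff.2 fun j => ?_
    by_cases h : j = k
    · subst h; simpa using measurable_fst
    · simpa [Function.update_of_ne h] using! (measurable_pi_apply j).comp measurable_snd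
  refine ⟨hm, (Measure.pi_eq fun s hs => ?_).symm⟩
  rw [Measure.map_apply hm (.univ_pi hs)]
  have : (fun p : ℝ × (κ → ℝ) => Function.update p.2 k p.1) ⁻¹' Set.univ.pi s
      = s k ×ˢ Set.univ.pi (Function.update s k Set.univ) := by
    ext p
    simp only [Set.mem_preimage, Set.mem_univ_pi, Set.mem_prod]
    constructor
    · refine fun h => ⟨by simpa using h k, fun j => ?_⟩
      by_cases hj : j = k
      · subst hj; simp
      · simpa [Function.update_of_ne hj] using h j
    · rintro ⟨h₁, h₂⟩ j
      by_cases hj : j = k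
      · subst hj; simpa using h₁
      · simpa [Function.update_of_ne hj] using h₂ j
  rw [this, Measure.prod_prod, Measure.pi_pi, ← Finset.mul_prod_erase _ _ (Finset.mem_univ k),
    ← Finset.mul_prod_erase _ (fun i => ν i (s i)) (Finset.mem_univ k)]
  simp only [Function.update_self, measure_univ, one_mul]
  congr 1
  refine Finset.prod_congr rfl fun j hj => ?_
  rw [Function.update_of_ne (Finset.ne_of_mem_erase hj)]

section Gibbs

variable {ι : Type*} [Fintype ι]

/-- The weight of `σ` under the Gibbs measure with exponents `E`. -/
noncomputable def gibbsWeight (E : ι → ℝ) (σ : ι) : ℝ := rexp (E σ) / ∑ τ, rexp (E τ)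

lemma gibbsWeight_nonneg (E : ι → ℝ) (σ : ι) : 0 ≤ gibbsWeight E σ := by
  unfold gibbsWeight; positivity

lemma gibbsWeight_le_one (E : ι → ℝ) (σ : ι) : gibbsWeight E σ ≤ 1 :=
  div_le_one_of_le₀ (Finset.single_le_sum (f := fun τ => rexp (E τ))
    (fun _ _ => (exp_pos _).le) (Finset.mem_univ σ)) (by positivity)

lemma norm_gibbsWeight_le_one (E : ι → ℝ) (σ : ι) : ‖gibbsWeight E σ‖ ≤ 1 := by
  rw [Real.norm_of_nonneg (gibbsWeight_nonneg E σ)]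
  exact gibbsWeight_le_one E σ

lemma sum_exp_pos [Nonempty ι] (E : ι → ℝ) : 0 < ∑ σ, rexp (E σ) :=
  Finset.sum_pos (fun _ _ => exp_pos _) Finset.univ_nonempty

lemma sum_gibbsWeight [Nonempty ι] (E : ι → ℝ) : ∑ σ, gibbsWeight E σ = 1 := by
  simp only [gibbsWeight]
  rw [← Finset.sum_div, div_self (sum_exp_pos E).ne']

lemma abs_sum_mul_gibbsWeight_le (b E : ι → ℝ) :
    |∑ σ, b σ * gibbsWeight E σ| ≤ ∑ σ, |b σ| := by
  refine (Finset.abs_sum_le_sum_abs _ _).trans (Finset.sum_le_sum fun σ _ => ?_)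
  rw [abs_mul]
  exact mul_le_of_le_one_right (abs_nonneg _) (norm_gibbsWeight_le_one E σ)

lemma hasDerivAt_sum_exp {e : ι → ℝ → ℝ} {e' : ι → ℝ} {x : ℝ}
    (he : ∀ σ, HasDerivAt (e σ) (e' σ) x) :
    HasDerivAt (fun y => ∑ σ, rexp (e σ y)) (∑ σ, rexp (e σ x) * e' σ) x :=
  HasDerivAt.fun_sum fun σ _ => (he σ).exp

lemma hasDerivAt_log_sum_exp [Nonempty ι] {e : ι → ℝ → ℝ} {e' : ι → ℝ} {x : ℝ}
    (he : ∀ σ, HasDerivAt (e σ) (e' σ) x) :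
    HasDerivAt (fun y => Real.log (∑ σ, rexp (e σ y)))
      (∑ σ, e' σ * gibbsWeight (fun τ => e τ x) σ) x := by
  convert! (hasDerivAt_sum_exp he).log (sum_exp_pos fun σ => e σ x).ne' using 1
  rw [Finset.sum_div]
  refine Finset.sum_congr rfl fun σ _ => ?_
  rw [gibbsWeight]
  ring

lemma hasDerivAt_gibbsWeight [Nonempty ι] {e : ι → ℝ → ℝ} {e' : ι → ℝ} {x : ℝ}
    (he : ∀ σ, HasDerivAt (e σ) (e' σ) x) (σ : ι) :
    HasDerivAt (fun y => gibbsWeight (fun τ => e τ y) σ)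
      (gibbsWeight (fun τ => e τ x) σ *
        (e' σ - ∑ τ, e' τ * gibbsWeight (fun τ => e τ x) τ)) x := by
  have hZ := (sum_exp_pos fun σ => e σ x).ne'
  convert! (he σ).exp.div (hasDerivAt_sum_exp he) hZ using 1
  have : ∑ τ, e' τ * gibbsWeight (fun τ => e τ x) τ
      = (∑ τ, rexp (e τ x) * e' τ) / ∑ τ, rexp (e τ x) := by
    rw [Finset.sum_div]
    refine Finset.sum_congr rfl fun σ _ => ?_
    rw [gibbsWeight]
    ring
  rw [this, gibbsWeight]
  field_simp

lemma abs_log_sum_exp_le [Nonempty ι] (E : ι → ℝ) :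
    |Real.log (∑ σ, rexp (E σ))| ≤ Real.log (Fintype.card ι) + ∑ σ, |E σ| := by
  have hcard : (1 : ℝ) ≤ Fintype.card ι := by exact_mod_cast Fintype.card_pos (α := ι)
  have hle : ∀ σ, |E σ| ≤ ∑ τ, |E τ| := fun σ =>
    Finset.single_le_sum (f := fun τ => |E τ|) (fun _ _ => abs_nonneg _) (Finset.mem_univ σ)
  rw [abs_le]
  constructor
  · obtain ⟨σ⟩ := ‹Nonempty ι›
    have h₁ : E σ ≤ Real.log (∑ τ, rexp (E τ)) := by
      rw [Real.le_log_iff_exp_le (sum_exp_pos E)]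
      exact Finset.single_le_sum (f := fun τ => rexp (E τ))
        (fun _ _ => (exp_pos _).le) (Finset.mem_univ σ)
    have h₂ := hle σ
    have h₃ := neg_abs_le (E σ)
    have h₄ := Real.log_nonneg hcard
    linarith
  · rw [Real.log_le_iff_le_exp (sum_exp_pos E), Real.exp_add, Real.exp_log (by linarith)]
    calc ∑ σ, rexp (E σ) ≤ ∑ _σ : ι, rexp (∑ τ, |E τ|) :=
          Finset.sum_le_sum fun σ _ => exp_le_exp.2 ((le_abs_self _).trans (hle σ))
      _ = _ := by simp

variable {Ω : Type*} [MeasurableSpace Ω]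

lemma measurable_gibbsWeight {H : ι → Ω → ℝ} (hH : ∀ σ, Measurable (H σ)) (σ : ι) :
    Measurable fun ω => gibbsWeight (fun τ => H τ ω) σ := by
  unfold gibbsWeight
  fun_prop

variable {μ : Measure Ω} [IsProbabilityMeasure μ]

lemma integrable_log_sum_exp [Nonempty ι] {H : ι → Ω → ℝ} (hH : ∀ σ, Measurable (H σ))
    (hHi : ∀ σ, Integrable (H σ) μ) :
    Integrable (fun ω => Real.log (∑ σ, rexp (H σ ω))) μ := by
  refine ((integrable_const (Real.log (Fintype.card ι))).add
    (integrable_finsetSum Finset.univ fun σ _ => (hHi σ).abs)).mono'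
    (Measurable.aestronglyMeasurable (by fun_prop)) (ae_of_all _ fun ω => ?_)
  exact abs_log_sum_exp_le fun σ => H σ ω

/-- The variance of a function of two replicas under the averaged Gibbs measure is nonnegative. -/
lemma sq_integral_sum_gibbsWeight_le [Nonempty ι] {H : ι → Ω → ℝ} (hH : ∀ σ, Measurable (H σ))
    (R : ι → ι → ℝ) :
    (∫ ω, ∑ σ, ∑ τ, R σ τ *
        (gibbsWeight (fun ρ => H ρ ω) σ * gibbsWeight (fun ρ => H ρ ω) τ) ∂μ) ^ 2
      ≤ ∫ ω, ∑ σ, ∑ τ, R σ τ ^ 2 *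
        (gibbsWeight (fun ρ => H ρ ω) σ * gibbsWeight (fun ρ => H ρ ω) τ) ∂μ := by
  have hpm := measurable_gibbsWeight hH
  have hp1 : ∀ ω, ∑ σ, gibbsWeight (fun ρ => H ρ ω) σ = 1 := fun ω => sum_gibbsWeight _
  have hp0 : ∀ σ ω, 0 ≤ gibbsWeight (fun ρ => H ρ ω) σ := fun σ ω => gibbsWeight_nonneg _ _
  have hpb : ∀ σ ω, ‖gibbsWeight (fun ρ => H ρ ω) σ‖ ≤ 1 := fun σ ω =>
    norm_gibbsWeight_le_one _ _
  generalize hp : (fun σ ω => gibbsWeight (fun ρ => H ρ ω) σ) = p at *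
  simp only [fun σ ω => show gibbsWeight (fun ρ => H ρ ω) σ = p σ ω by rw [← hp]] at *
  set c := ∫ ω, ∑ σ, ∑ τ, R σ τ * (p σ ω * p τ ω) ∂μ with hc
  have hpp : ∀ σ τ, Integrable (fun ω => p σ ω * p τ ω) μ := fun σ τ =>
    .of_bound ((hpm σ).mul (hpm τ)).aestronglyMeasurable 1 (ae_of_all _ fun ω => by
      rw [norm_mul]
      exact mul_le_one₀ (hpb σ ω) (norm_nonneg _) (hpb τ ω))
  have hint : ∀ f : ι → ι → ℝ, Integrable (fun ω => ∑ σ, ∑ τ, f σ τ * (p σ ω * p τ ω)) μ :=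
    fun f => integrable_finsetSum _ fun σ _ => integrable_finsetSum _ fun τ _ =>
      (hpp σ τ).const_mul _
  have hexpand : ∫ ω, ∑ σ, ∑ τ, (R σ τ - c) ^ 2 * (p σ ω * p τ ω) ∂μ
      = ∫ ω, ∑ σ, ∑ τ, R σ τ ^ 2 * (p σ ω * p τ ω) ∂μ - 2 * c * c + c ^ 2 := by
    calc _ = ∫ ω, ((∑ σ, ∑ τ, R σ τ ^ 2 * (p σ ω * p τ ω))
          - 2 * c * (∑ σ, ∑ τ, R σ τ * (p σ ω * p τ ω)) + c ^ 2) ∂μ := by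
          refine integral_congr_ae (ae_of_all _ fun ω => ?_)
          have h₁ : c ^ 2 = ∑ σ, ∑ τ, c ^ 2 * (p σ ω * p τ ω) := by
            simp only [← Finset.mul_sum, hp1, mul_one]
          beta_reduce
          rw [h₁]
          simp only [Finset.mul_sum, ← Finset.sum_sub_distrib, ← Finset.sum_add_distrib]
          exact Finset.sum_congr rfl fun σ _ => Finset.sum_congr rfl fun τ _ => by ring
      _ = _ := by
          have hsub : Integrable (fun ω => (∑ σ, ∑ τ, R σ τ ^ 2 * (p σ ω * p τ ω))
              - 2 * c * (∑ σ, ∑ τ, R σ τ * (p σ ω * p τ ω))) μ :=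
            (hint fun σ τ => R σ τ ^ 2).sub ((hint R).const_mul _)
          rw [integral_add hsub (integrable_const _), integral_sub (hint fun σ τ => R σ τ ^ 2)
            ((hint R).const_mul _), integral_const_mul, ← hc]
          simp
  have hnonneg : 0 ≤ ∫ ω, ∑ σ, ∑ τ, (R σ τ - c) ^ 2 * (p σ ω * p τ ω) ∂μ :=
    integral_nonneg fun ω => Finset.sum_nonneg fun σ _ => Finset.sum_nonneg fun τ _ =>
      mul_nonneg (sq_nonneg _) (mul_nonneg (hp0 σ ω) (hp0 τ ω))
  rw [hexpand] at hnonneg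
  linarith

/-- Gaussian integration by parts for a Gibbs weight whose exponents depend linearly on the
Gaussian coordinate `X`. -/
lemma integral_mul_gibbsWeight [Nonempty ι] {X : Ω → ℝ} {T : ℝ → Ω → Ω} {H : ι → Ω → ℝ}
    {b : ι → ℝ}
    (hT : MeasurePreserving (fun p : ℝ × Ω => T p.1 p.2) ((gaussianReal 0 1).prod μ) μ)
    (hX : Measurable X) (hXT : ∀ x ω, X (T x ω) = x) (hH : ∀ σ, Measurable (H σ))
    (hderiv : ∀ σ x ω, HasDerivAt (fun y => H σ (T y ω)) (b σ) x) (σ : ι) :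
    ∫ ω, X ω * gibbsWeight (fun τ => H τ ω) σ ∂μ
      = ∫ ω, gibbsWeight (fun τ => H τ ω) σ *
          (b σ - ∑ τ, b τ * gibbsWeight (fun τ => H τ ω) τ) ∂μ := by
  have hp := measurable_gibbsWeight hH
  refine integral_mul_of_measurePreserving (C := 1) (C' := |b σ| + ∑ τ, |b τ|) hT hX hXT (hp σ)
    ((hp σ).mul (measurable_const.sub (Finset.measurable_sum _ fun τ _ => (hp τ).const_mul _)))
    (fun ω => norm_gibbsWeight_le_one _ _) (fun ω => ?_)
    (fun x ω => hasDerivAt_gibbsWeight (fun τ => hderiv τ x ω) σ)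
  rw [norm_mul]
  refine (mul_le_of_le_one_left (norm_nonneg _) (norm_gibbsWeight_le_one _ _)).trans ?_
  exact (abs_sub _ _).trans (add_le_add le_rfl (abs_sum_mul_gibbsWeight_le b _))

variable {K : Type*} [Fintype K] [DecidableEq K]

/-- Derivative in `s` of the expected log-partition function with exponents
`√(2s) ∑ₖ a σ k Xₖ − v s + C σ`, where the `Xₖ` are i.i.d. standard Gaussians and each Gaussian
field has variance `v`. -/
theorem hasDerivAt_integral_log_sum_exp [Nonempty ι] {X : K → Ω → ℝ} {T : K → ℝ → Ω → Ω}
    {a : ι → K → ℝ} {C : ι → Ω → ℝ} {v s : ℝ}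
    (hT : ∀ k, MeasurePreserving (fun p : ℝ × Ω => T k p.1 p.2) ((gaussianReal 0 1).prod μ) μ)
    (hX : ∀ k, Measurable (X k))
    (hXT : ∀ j k x ω, X j (T k x ω) = if j = k then x else X j ω)
    (hCm : ∀ σ, Measurable (C σ)) (hCi : ∀ σ, Integrable (C σ) μ)
    (hCT : ∀ σ k x ω, C σ (T k x ω) = C σ ω)
    (ha : ∀ σ, ∑ k, a σ k * a σ k = v) (hs : 0 < s) :
    HasDerivAt (fun r => ∫ ω, Real.log (∑ σ,
        rexp (√(2 * r) * ∑ k, a σ k * X k ω - v * r + C σ ω)) ∂μ)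
      (-∫ ω, ∑ σ, ∑ τ, (∑ k, a σ k * a τ k) *
        (gibbsWeight (fun ρ => √(2 * s) * ∑ k, a ρ k * X k ω - v * s + C ρ ω) σ *
          gibbsWeight (fun ρ => √(2 * s) * ∑ k, a ρ k * X k ω - v * s + C ρ ω) τ) ∂μ) s := by
  have hXi : ∀ k, Integrable (X k) μ := fun k =>
    integrable_of_measurePreserving_resample (hT k) (hX k) fun x ω => by simp [hXT]
  have hAi : ∀ σ, Integrable (fun ω => ∑ k, a σ k * X k ω) μ := fun σ =>
    integrable_finsetSum _ fun k _ => (hXi k).const_mul _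
  set H : ℝ → ι → Ω → ℝ := fun r σ ω => √(2 * r) * ∑ k, a σ k * X k ω - v * r + C σ ω with hHdef
  have hHm : ∀ r σ, Measurable (H r σ) := fun r σ => by
    simp only [hHdef]
    fun_prop
  have hHi : ∀ r σ, Integrable (H r σ) μ := fun r σ =>
    (((hAi σ).const_mul _).sub (integrable_const _)).add (hCi σ)
  have hder : ∀ r, 0 < r → ∀ σ ω, HasDerivAt (fun r => H r σ ω)
      ((√(2 * r))⁻¹ * (∑ k, a σ k * X k ω) - v) r := by
    intro r hr σ ω
    have h₁ : HasDerivAt (fun r : ℝ => √(2 * r)) ((√(2 * r))⁻¹) r := by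
      convert! ((hasDerivAt_id r).const_mul 2).sqrt (by simpa using hr.ne') using 1
      simp only [id_eq]
      field_simp
    convert! ((h₁.mul_const (∑ k, a σ k * X k ω)).sub ((hasDerivAt_id r).const_mul v)).add_const
      (C σ ω) using 1
    ring
  have hpm : ∀ r σ, Measurable fun ω => gibbsWeight (fun τ => H r τ ω) σ := fun r σ =>
    measurable_gibbsWeight (hHm r) σ
  have main := (hasDerivAt_integral_of_dominated_loc_of_deriv_le (μ := μ)
    (F := fun r ω => Real.log (∑ σ, rexp (H r σ ω)))
    (F' := fun r ω => ∑ σ, ((√(2 * r))⁻¹ * (∑ k, a σ k * X k ω) - v) *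
      gibbsWeight (fun τ => H r τ ω) σ)
    (bound := fun ω => ∑ σ, ((√s)⁻¹ * |∑ k, a σ k * X k ω| + |v|))
    (Ioi_mem_nhds (half_lt_self hs))
    (.of_forall fun r => (integrable_log_sum_exp (hHm r) (hHi r)).aestronglyMeasurable)
    (integrable_log_sum_exp (hHm s) (hHi s)) (by fun_prop)
    (ae_of_all _ fun ω r hr => ?_)
    (integrable_finsetSum _ fun σ _ => ((hAi σ).abs.const_mul _).add (integrable_const _))
    (ae_of_all _ fun ω r hr => hasDerivAt_log_sum_exp fun σ =>
      hder r ((half_pos hs).trans hr) σ ω)).2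
  · convert! main using 1
    set q := √(2 * s)
    have hq0 : q ≠ 0 := (Real.sqrt_pos.2 (by linarith)).ne'
    set p : ι → Ω → ℝ := fun σ ω => gibbsWeight (fun τ => H s τ ω) σ
    have hpb : ∀ σ ω, ‖p σ ω‖ ≤ 1 := fun σ ω => norm_gibbsWeight_le_one _ _
    have hp1 : ∀ ω, ∑ σ, p σ ω = 1 := fun ω => sum_gibbsWeight _
    have hpi : ∀ σ, Integrable (p σ) μ := fun σ =>
      .of_bound (hpm s σ).aestronglyMeasurable 1 (ae_of_all _ (hpb σ))
    have hXp : ∀ σ k, Integrable (fun ω => X k ω * p σ ω) μ := fun σ k =>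
      (hXi k).mul_bdd (hpm s σ).aestronglyMeasurable (ae_of_all _ (hpb σ))
    have hG : ∀ σ k, Integrable
        (fun ω => p σ ω * (q * a σ k - ∑ τ, q * a τ k * p τ ω)) μ := fun σ k =>
      ((integrable_const _).sub (integrable_finsetSum _ fun τ _ => (hpi τ).const_mul _)).bdd_mul
        (hpm s σ).aestronglyMeasurable (ae_of_all _ (hpb σ))
    have hstein : ∀ σ k, ∫ ω, X k ω * p σ ω ∂μ
        = ∫ ω, p σ ω * (q * a σ k - ∑ τ, q * a τ k * p τ ω) ∂μ := by
      intro σ k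
      refine integral_mul_gibbsWeight (b := fun τ => q * a τ k) (hT k) (hX k) (fun x ω => by simp [hXT]) (hHm s)
        (fun τ x ω => ?_) σ
      have h₁ : ∀ j, HasDerivAt (fun y => X j (T k y ω)) (if j = k then 1 else 0) x := by
        intro j
        simp only [hXT]
        split_ifs
        · exact hasDerivAt_id x
        · exact hasDerivAt_const _ _
      have h₂ := (((HasDerivAt.fun_sum fun j (_ : j ∈ Finset.univ) =>
        (h₁ j).const_mul (a τ j)).const_mul q).sub_const (v * s)).add_const (C τ ω)
      simp only [mul_ite, mul_one, mul_zero, Finset.sum_ite_eq', Finset.mem_univ, if_true] at h₂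
      simpa only [hHdef, hCT] using h₂
    symm
    calc ∫ ω, ∑ σ, (q⁻¹ * (∑ k, a σ k * X k ω) - v) * p σ ω ∂μ
        = ∫ ω, ((∑ σ, ∑ k, q⁻¹ * a σ k * (X k ω * p σ ω)) - v) ∂μ := by
          refine integral_congr_ae (ae_of_all _ fun ω => ?_)
          simp only [sub_mul, Finset.sum_sub_distrib, ← Finset.mul_sum, hp1, mul_one]
          congr 1
          refine Finset.sum_congr rfl fun σ _ => ?_
          rw [Finset.mul_sum, Finset.sum_mul]
          exact Finset.sum_congr rfl fun k _ => by ring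
      _ = (∑ σ, ∑ k, q⁻¹ * a σ k * ∫ ω, X k ω * p σ ω ∂μ) - v := by
          rw [integral_sub (integrable_finsetSum _ fun σ _ => integrable_finsetSum _ fun k _ =>
            (hXp σ k).const_mul _) (integrable_const _), integral_finsetSum _ fun σ _ =>
            integrable_finsetSum _ fun k _ => (hXp σ k).const_mul _]
          simp only [integral_finsetSum _ fun k _ => (hXp _ k).const_mul _, integral_const_mul,
            integral_const, probReal_univ, one_smul]
      _ = (∑ σ, ∑ k, q⁻¹ * a σ k *
            ∫ ω, p σ ω * (q * a σ k - ∑ τ, q * a τ k * p τ ω) ∂μ) - v := by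
          simp only [hstein]
      _ = ∫ ω, ((∑ σ, ∑ k, q⁻¹ * a σ k *
            (p σ ω * (q * a σ k - ∑ τ, q * a τ k * p τ ω))) - v) ∂μ := by
          rw [integral_sub (integrable_finsetSum _ fun σ _ => integrable_finsetSum _ fun k _ =>
            (hG σ k).const_mul _) (integrable_const _), integral_finsetSum _ fun σ _ =>
            integrable_finsetSum _ fun k _ => (hG σ k).const_mul _]
          simp only [integral_finsetSum _ fun k _ => (hG _ k).const_mul _, integral_const_mul,
            integral_const, probReal_univ, one_smul]
      _ = _ := by
          rw [← integral_neg]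
          refine integral_congr_ae (ae_of_all _ fun ω => ?_)
          have h₁ : ∀ σ, ∑ k, q⁻¹ * a σ k * (p σ ω * (q * a σ k - ∑ τ, q * a τ k * p τ ω))
              = v * p σ ω - ∑ τ, (∑ k, a σ k * a τ k) * (p σ ω * p τ ω) := by
            intro σ
            simp only [← ha σ, Finset.sum_mul]
            rw [Finset.sum_comm (s := Finset.univ (α := ι)), ← Finset.sum_sub_distrib]
            refine Finset.sum_congr rfl fun k _ => ?_
            have : ∑ τ, q * a τ k * p τ ω = q * ∑ τ, a τ k * p τ ω := by
              rw [Finset.mul_sum]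
              exact Finset.sum_congr rfl fun _ _ => by ring
            rw [this, ← mul_sub]
            have h₂ : ∑ τ, a σ k * a τ k * (p σ ω * p τ ω)
                = a σ k * p σ ω * ∑ τ, a τ k * p τ ω := by
              rw [Finset.mul_sum]
              exact Finset.sum_congr rfl fun _ _ => by ring
            rw [h₂]
            field_simp
          simp only [h₁, Finset.sum_sub_distrib, ← Finset.mul_sum, hp1]
          ring
  · refine (Finset.abs_sum_le_sum_abs _ _).trans (Finset.sum_le_sum fun σ _ => ?_)
    rw [abs_mul]
    refine (mul_le_of_le_one_right (abs_nonneg _) (norm_gibbsWeight_le_one _ _)).trans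
      ((abs_sub _ _).trans (add_le_add ?_ le_rfl))
    rw [abs_mul, abs_of_nonneg (by positivity)]
    have hr' : s / 2 < r := hr
    have hsq : √s ≤ √(2 * r) := Real.sqrt_le_sqrt (by linarith)
    have := Real.sqrt_pos.2 hs
    gcongr

end Gibbs

section SK

variable {N : ℕ}

instance isProbabilityMeasure_measWZ : IsProbabilityMeasure (measWZ N) := by
  unfold measWZ; infer_instance

lemma measurePreserving_update_fst (k : Fin N × Fin N) :
    MeasurePreserving (fun p : ℝ × (((Fin N × Fin N) → ℝ) × (Fin N → ℝ)) =>
      (Function.update p.2.1 k p.1, p.2.2)) ((gaussianReal 0 1).prod (measWZ N)) (measWZ N) :=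
  ((measurePreserving_update_pi (fun _ : Fin N × Fin N => gaussianReal 0 1) k).prod
    (.id (Measure.pi fun _ : Fin N => gaussianReal 0 1))).comp
    (measurePreserving_prodAssoc (gaussianReal 0 1) _ _).symm

lemma measurePreserving_update_snd (k : Fin N) :
    MeasurePreserving (fun p : ℝ × (((Fin N × Fin N) → ℝ) × (Fin N → ℝ)) =>
      (p.2.1, Function.update p.2.2 k p.1)) ((gaussianReal 0 1).prod (measWZ N)) (measWZ N) :=
  (((MeasurePreserving.id (Measure.pi fun _ : Fin N × Fin N => gaussianReal 0 1)).prod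
    (measurePreserving_update_pi (fun _ : Fin N => gaussianReal 0 1) k)).comp
    (measurePreserving_prodAssoc _ (gaussianReal 0 1) _)).comp
    (((Measure.measurePreserving_swap (μ := gaussianReal 0 1)
      (ν := Measure.pi fun _ : Fin N × Fin N => gaussianReal 0 1)).prod
      (.id (Measure.pi fun _ : Fin N => gaussianReal 0 1))).comp
      (measurePreserving_prodAssoc (gaussianReal 0 1) _ _).symm)

lemma integrable_fst_apply (k : Fin N × Fin N) :
    Integrable (fun ω : ((Fin N × Fin N) → ℝ) × (Fin N → ℝ) => ω.1 k) (measWZ N) :=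
  integrable_of_measurePreserving_resample (T := fun x ω => (Function.update ω.1 k x, ω.2))
    (measurePreserving_update_fst k) (by fun_prop) fun x ω => by simp

lemma integrable_snd_apply (k : Fin N) :
    Integrable (fun ω : ((Fin N × Fin N) → ℝ) × (Fin N → ℝ) => ω.2 k) (measWZ N) :=
  integrable_of_measurePreserving_resample (T := fun x ω => (ω.1, Function.update ω.2 k x))
    (measurePreserving_update_snd k) (by fun_prop) fun x ω => by simp

instance nonempty_spin : Nonempty ({-1, 1} : Finset ℝ) := ⟨-1, by simp⟩

lemma spin_mul_self (x : ({-1, 1} : Finset ℝ)) : (x : ℝ) * x = 1 := by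
  obtain ⟨x, hx⟩ := x
  simp only [Finset.mem_insert, Finset.mem_singleton] at hx
  rcases hx with rfl | rfl <;> norm_num

lemma gibbsOverlap_eq (t h : ℝ) (f : ℝ → ℝ) :
    gibbsOverlap N t h f = ∫ ω, ∑ σ : Fin N → ({-1, 1} : Finset ℝ),
      ∑ τ : Fin N → ({-1, 1} : Finset ℝ), f ((∑ i, (σ i : ℝ) * (τ i : ℝ)) / N) *
        (gibbsWeight (fun ρ : Fin N → ({-1, 1} : Finset ℝ) => Henr N t h ω fun i => ρ i) σ *
          gibbsWeight (fun ρ : Fin N → ({-1, 1} : Finset ℝ) => Henr N t h ω fun i => ρ i) τ)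
      ∂(measWZ N) := by
  refine integral_congr_ae (ae_of_all _ fun ω => ?_)
  simp only [Finset.sum_div, gibbsWeight, Zenr, Real.exp_add]
  refine Finset.sum_congr rfl fun σ _ => Finset.sum_congr rfl fun τ _ => ?_
  ring

lemma hasDerivAt_Fenr_left (hN : 1 ≤ N) {t h : ℝ} (ht : 0 < t) :
    HasDerivAt (fun s => Fenr N s h) (gibbsOverlap N t h fun R => R ^ 2) t := by
  have hN0 : (0 : ℝ) < N := by exact_mod_cast hN
  have hsq : (1 / √(N : ℝ)) * (1 / √(N : ℝ)) = 1 / N := by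
    rw [div_mul_div_comm, one_mul, Real.mul_self_sqrt hN0.le]
  have ha : ∀ σ τ : Fin N → ({-1, 1} : Finset ℝ),
      ∑ k : Fin N × Fin N, (1 / √(N : ℝ) * (σ k.1 * σ k.2)) * (1 / √(N : ℝ) * (τ k.1 * τ k.2))
        = N * ((∑ i, (σ i : ℝ) * (τ i : ℝ)) / N) ^ 2 := by
    intro σ τ
    have h₁ : N * ((∑ i, (σ i : ℝ) * (τ i : ℝ)) / N) ^ 2
        = 1 / N * ((∑ i, (σ i : ℝ) * (τ i : ℝ)) * ∑ i, (σ i : ℝ) * (τ i : ℝ)) := by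
      field_simp
    rw [h₁, Finset.sum_mul_sum, Fintype.sum_prod_type, Finset.mul_sum, ← hsq]
    refine Finset.sum_congr rfl fun i _ => ?_
    rw [Finset.mul_sum]
    exact Finset.sum_congr rfl fun j _ => by ring
  have key := hasDerivAt_integral_log_sum_exp (μ := measWZ N) (s := t) (v := N)
    (X := fun k ω => ω.1 k) (T := fun k x ω => (Function.update ω.1 k x, ω.2))
    (a := fun (σ : Fin N → ({-1, 1} : Finset ℝ)) k => 1 / √(N : ℝ) * (σ k.1 * σ k.2))
    (C := fun σ ω => √(2 * h) * (∑ i, ω.2 i * σ i) - N * h)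
    measurePreserving_update_fst (fun k => by fun_prop)
    (fun j k x ω => by simp [Function.update_apply]) (fun σ => by fun_prop)
    (fun σ => ((integrable_finsetSum _ fun i _ =>
      (integrable_snd_apply i).mul_const _).const_mul _).sub (integrable_const _))
    (fun σ k x ω => rfl)
    (fun σ => by rw [ha]; simp [spin_mul_self, hN0.ne']) ht
  have hH : ∀ r ω (σ : Fin N → ({-1, 1} : Finset ℝ)),
      √(2 * r) * (∑ k, 1 / √(N : ℝ) * (σ k.1 * σ k.2) * ω.1 k) - N * r
        + (√(2 * h) * (∑ i, ω.2 i * (σ i : ℝ)) - N * h) = Henr N r h ω fun i => σ i := by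
    intro r ω σ
    have : ∑ k, 1 / √(N : ℝ) * (σ k.1 * σ k.2) * ω.1 k = HSK N ω.1 fun i => σ i := by
      rw [HSK, Fintype.sum_prod_type, Finset.mul_sum]
      refine Finset.sum_congr rfl fun i _ => ?_
      rw [Finset.mul_sum]
      exact Finset.sum_congr rfl fun j _ => by ring
    rw [this, Henr]
    ring
  simp only [hH, ha] at key
  convert! key.const_mul (-(1 / N : ℝ)) using 1
  rw [gibbsOverlap_eq, neg_mul_neg, ← integral_const_mul]
  simp only [Finset.mul_sum]
  refine integral_congr_ae (ae_of_all _ fun ω => Finset.sum_congr rfl fun σ _ =>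
    Finset.sum_congr rfl fun τ _ => ?_)
  field_simp

lemma hasDerivAt_Fenr_right (hN : 1 ≤ N) {t h : ℝ} (hh : 0 < h) :
    HasDerivAt (fun g => Fenr N t g) (gibbsOverlap N t h fun R => R) h := by
  have hN0 : (0 : ℝ) < N := by exact_mod_cast hN
  have key := hasDerivAt_integral_log_sum_exp (μ := measWZ N) (s := h) (v := N)
    (X := fun k ω => ω.2 k) (T := fun k x ω => (ω.1, Function.update ω.2 k x))
    (a := fun (σ : Fin N → ({-1, 1} : Finset ℝ)) k => (σ k : ℝ))
    (C := fun σ ω => √(2 * t) * HSK N ω.1 (fun i => σ i) - N * t)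
    measurePreserving_update_snd (fun k => by fun_prop)
    (fun j k x ω => by simp [Function.update_apply])
    (fun σ => by unfold HSK; fun_prop)
    (fun σ => (Integrable.const_mul (Integrable.const_mul
      (integrable_finsetSum _ fun i _ => integrable_finsetSum _ fun j _ =>
        ((integrable_fst_apply (i, j)).mul_const _).mul_const _) _) _).sub (integrable_const _))
    (fun σ k x ω => rfl)
    (fun σ => by simp [spin_mul_self]) hh
  have hH : ∀ r ω (σ : Fin N → ({-1, 1} : Finset ℝ)),
      √(2 * r) * (∑ k, (σ k : ℝ) * ω.2 k) - N * r + (√(2 * t) * HSK N ω.1 (fun i => σ i) - N * t)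
        = Henr N t r ω fun i => σ i := by
    intro r ω σ
    simp only [Henr, mul_comm (ω.2 _)]
    ring
  simp only [hH] at key
  convert! key.const_mul (-(1 / N : ℝ)) using 1
  rw [gibbsOverlap_eq, neg_mul_neg, ← integral_const_mul]
  simp only [Finset.mul_sum]
  refine integral_congr_ae (ae_of_all _ fun ω => Finset.sum_congr rfl fun σ _ =>
    Finset.sum_congr rfl fun τ _ => ?_)
  field_simp

/-- The variance of the overlap is nonnegative. -/
lemma sq_gibbsOverlap_le (t h : ℝ) :
    (gibbsOverlap N t h fun R => R) ^ 2 ≤ gibbsOverlap N t h fun R => R ^ 2 := by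
  have hHm : ∀ σ : Fin N → ({-1, 1} : Finset ℝ),
      Measurable fun ω => Henr N t h ω fun i => (σ i : ℝ) := fun σ => by
    unfold Henr HSK
    fun_prop
  rw [gibbsOverlap_eq, gibbsOverlap_eq]
  exact sq_integral_sum_gibbsWeight_le hHm fun σ τ => (∑ i, (σ i : ℝ) * (τ i : ℝ)) / N

end SK

/-- For every `t > 0` and `h > 0`, the defect in the Hamilton–Jacobi equation
`∂ₜF_N = (∂ₕF_N)²` equals the variance of the overlap `(σ·σ')/N` under `E⟨·⟩`:
`∂ₜF_N(t,h) − (∂ₕF_N(t,h))² = E⟨((σ·σ')/N)²⟩ − (E⟨(σ·σ')/N⟩)²`; in particular this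
quantity is nonnegative. -/
theorem hamilton_jacobi_defect (N : ℕ) (hN : 1 ≤ N) (t h : ℝ) (ht : 0 < t) (hh : 0 < h) :
    deriv (fun s => Fenr N s h) t - (deriv (fun g => Fenr N t g) h) ^ 2
        = gibbsOverlap N t h (fun R => R ^ 2) - (gibbsOverlap N t h fun R => R) ^ 2 ∧
    0 ≤ gibbsOverlap N t h (fun R => R ^ 2) - (gibbsOverlap N t h fun R => R) ^ 2 := by
  rw [(hasDerivAt_Fenr_left hN ht).deriv, (hasDerivAt_Fenr_right hN hh).deriv]
  exact ⟨rfl, sub_nonneg.2 (sq_gibbsOverlap_le t h)⟩
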